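/- Let G be a finite connected distance-hereditary graph. Then the center C(G) is a diameter certificate: for every vertex v of G, min_{c ∈ C(G)} ( d(v,c) + e(c) ) ≤ diam(G); equivalently, for every vertex v there is a central vertex c with d(v,c) + rad(G) ≤ diam(G). -/

import Mathlib

/-- A graph is distance-hereditary if every connected induced subgraph is isometric
(equivalently, every induced path is a shortest path). -/
def DistHereditary {V : Type*} (G : SimpleGraph V) : Prop :=
  ∀ s : Set V, (G.induce s).Connected →
    ∀ u v : s, (G.induce s).dist u v = G.dist (u : V) (v : V)

/-- Eccentricity of a vertex: `e(v) = max_{u} d(v,u)`. -/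
noncomputable def ecc {V : Type*} [Fintype V] (G : SimpleGraph V) (v : V) : ℕ :=
  Finset.univ.sup (fun u => G.dist v u)

/-- Radius: minimum eccentricity. -/
noncomputable def rad {V : Type*} [Fintype V] (G : SimpleGraph V) : ℕ :=
  sInf (Set.range (ecc G))

/-- Diameter: maximum eccentricity. -/
noncomputable def diam {V : Type*} [Fintype V] (G : SimpleGraph V) : ℕ :=
  Finset.univ.sup (fun v => ecc G v)

/-- The center: vertices of minimum eccentricity. -/
def center {V : Type*} [Fintype V] (G : SimpleGraph V) : Set V :=
  {v | ecc G v = rad G}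

/-- Distance from a vertex to a set of vertices: `d(v,S) = min_{s ∈ S} d(v,s)`. -/
noncomputable def distToSet {V : Type*} (G : SimpleGraph V) (v : V) (S : Set V) : ℕ :=
  sInf ((G.dist v) '' S)

/-- The interval `I(x,y)`: vertices on shortest `(x,y)`-paths. -/
def interval {V : Type*} (G : SimpleGraph V) (x y : V) : Set V :=
  {v | G.dist x v + G.dist v y = G.dist x y}

/-- The intervalSlice `S_k(x,y) = {v ∈ I(x,y) : d(x,v) = k}`. -/
def intervalSlice {V : Type*} (G : SimpleGraph V) (x y : V) (k : ℕ) : Set V :=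
  {v | v ∈ interval G x y ∧ G.dist x v = k}

/-- The set `S` induces a cograph in `G`: no induced path on four vertices within `S`. -/
def IsCographOn {V : Type*} (G : SimpleGraph V) (S : Set V) : Prop :=
  ¬ ∃ a b c d : V, a ∈ S ∧ b ∈ S ∧ c ∈ S ∧ d ∈ S ∧
    a ≠ c ∧ a ≠ d ∧ b ≠ d ∧
    G.Adj a b ∧ G.Adj b c ∧ G.Adj c d ∧ ¬ G.Adj a c ∧ ¬ G.Adj a d ∧ ¬ G.Adj b d

theorem dist_le_dist_succ_of_adj {V : Type*} {G : SimpleGraph V} (hconn : G.Connected)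
    (p : V) {a b : V} (hab : G.Adj a b) : G.dist p b ≤ G.dist p a + 1 := by
  have h := hconn.dist_triangle (u := p) (v := a) (w := b)
  rwa [SimpleGraph.dist_eq_one_iff_adj.mpr hab] at h

theorem exists_adj_dist_eq {V : Type*} {G : SimpleGraph V} (hconn : G.Connected)
    {p b : V} {n : ℕ} (h : G.dist p b = n + 1) : ∃ z, G.Adj z b ∧ G.dist p z = n := by
  obtain ⟨W, hW⟩ := hconn.exists_walk_length_eq_dist b p
  rw [SimpleGraph.dist_comm, h] at hW
  cases W with
  | nil => simp at hW
  | @cons _ z _ hadj q =>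
    refine ⟨z, hadj.symm, ?_⟩
    have h1 := SimpleGraph.dist_le q
    have h2 := dist_le_dist_succ_of_adj hconn p hadj.symm
    rw [SimpleGraph.dist_comm] at h1
    simp only [SimpleGraph.Walk.length_cons] at hW
    omega

/-- In a distance-hereditary graph, two vertices at distance `i + 1` from `p` which are joined by
a walk avoiding the ball of radius `i` around `p` have the same neighbours at distance `i`. -/
theorem DistHereditary.adj_of_walk {V : Type*} {G : SimpleGraph V} (hconn : G.Connected)
    (hdh : DistHereditary G) {p a b x : V} {i : ℕ} (q : G.Walk a b)
    (hq : ∀ t ∈ q.support, i + 1 ≤ G.dist p t) (hb : G.dist p b = i + 1)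
    (hx : G.dist p x = i) (hxa : G.Adj x a) : G.Adj x b := by
  obtain ⟨g, hg⟩ := hconn.exists_walk_length_eq_dist p x
  let W := g.append (.cons hxa q)
  have hs := W.connected_induce_support
  have hpb := hdh _ hs ⟨p, W.start_mem_support⟩ ⟨b, W.end_mem_support⟩
  obtain ⟨⟨z, hzW⟩, hzb, hz⟩ := exists_adj_dist_eq hs (hpb.trans hb)
  rw [hdh _ hs] at hz
  have hzb' : G.Adj z b := hzb
  have hzg : z ∈ g.support := by
    have hzW' : z ∈ W.support := hzW
    rw [SimpleGraph.Walk.mem_support_append_iff, SimpleGraph.Walk.support_cons,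
      List.mem_cons] at hzW'
    rcases hzW' with h | rfl | h
    · exact h
    · exact g.end_mem_support
    · have := hq z h
      simp only at hz
      omega
  classical
  have h1 := SimpleGraph.dist_le (g.takeUntil z hzg)
  have h2 := SimpleGraph.dist_le (g.dropUntil z hzg)
  have h3 := congrArg SimpleGraph.Walk.length (g.take_spec hzg)
  rw [SimpleGraph.Walk.length_append] at h3
  have hzx : G.dist z x = 0 := by
    simp only at hz
    omega
  rw [hconn.dist_eq_zero_iff] at hzx
  exact hzx ▸ hzb'

theorem DistHereditary.adj_of_adj {V : Type*} {G : SimpleGraph V} (hconn : G.Connected)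
    (hdh : DistHereditary G) {p a b x : V} {i : ℕ} (hab : G.Adj a b)
    (ha : G.dist p a = i + 1) (hb : G.dist p b = i + 1)
    (hx : G.dist p x = i) (hxa : G.Adj x a) : G.Adj x b :=
  hdh.adj_of_walk hconn (.cons hab .nil) (by simp [ha, hb]) hb hx hxa

theorem DistHereditary.adj_of_common_adj {V : Type*} {G : SimpleGraph V} (hconn : G.Connected)
    (hdh : DistHereditary G) {p a b x y : V} {i : ℕ} (hay : G.Adj a y) (hyb : G.Adj y b)
    (ha : G.dist p a = i + 1) (hb : G.dist p b = i + 1) (hy : G.dist p y = i + 2)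
    (hx : G.dist p x = i) (hxa : G.Adj x a) : G.Adj x b :=
  hdh.adj_of_walk hconn (.cons hay (.cons hyb .nil)) (by simp [ha, hb, hy]) hb hx hxa

/-- If the edge `c c'` points away from `u` and towards `v`, then either `c` and `c'` lie on a
shortest path from `u` to `v`, or some neighbour of `c` is closer than `c` to both `u` and `v`. -/
theorem DistHereditary.dist_eq_or_exists_closer {V : Type*} {G : SimpleGraph V}
    (hconn : G.Connected) (hdh : DistHereditary G) {u v : V} {r : ℕ} :
    ∀ {c c' : V} {k : ℕ}, G.Adj c c' → G.dist u c = r → G.dist u c' = r + 1 →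
      G.dist v c = k + 1 → G.dist v c' = k →
      G.dist u v = r + k + 1 ∨
        ∃ w, G.Adj w c ∧ G.dist u w + 1 = r ∧ G.dist v w = k := by
  induction r with
  | zero =>
    intro c c' k _ huc _ hvc _
    rw [hconn.dist_eq_zero_iff] at huc
    subst huc
    left
    rw [SimpleGraph.dist_comm, hvc, Nat.zero_add]
  | succ r ih =>
    intro c c' k hcc huc huc' hvc hvc'
    obtain ⟨x, hxc, hux⟩ := exists_adj_dist_eq hconn huc
    have h1 := dist_le_dist_succ_of_adj hconn v hxc
    have h2 := dist_le_dist_succ_of_adj hconn v hxc.symm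
    have hvx : G.dist v x = k ∨ G.dist v x = k + 1 ∨ G.dist v x = k + 2 := by omega
    rcases hvx with hvx | hvx | hvx
    · exact Or.inr ⟨x, hxc, by omega, hvx⟩
    · have := dist_le_dist_succ_of_adj hconn u
        (hdh.adj_of_adj hconn hxc.symm hvc hvx hvc' hcc.symm).symm
      omega
    · rcases ih hxc hux huc hvx hvc with h | ⟨w, hwx, huw, hvw⟩
      · left
        omega
      · have := dist_le_dist_succ_of_adj hconn u
          (hdh.adj_of_common_adj hconn hxc.symm hwx.symm hvc hvw hvx hvc' hcc.symm).symm
        omega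

/-- Two neighbours `a`, `b` of `c` which are incomparable with respect to the far vertices
`u₁`, `u₂` at distance `r` from `c` force `u₁` and `u₂` to be at distance `2 * r`. -/
theorem DistHereditary.dist_eq_two_mul {V : Type*} {G : SimpleGraph V}
    (hconn : G.Connected) (hdh : DistHereditary G) {a b c u₁ u₂ : V} {r : ℕ}
    (hac : G.Adj a c) (hbc : G.Adj b c)
    (h₁c : G.dist u₁ c = r) (h₁a : G.dist u₁ a = r + 1) (h₁b : G.dist u₁ b + 1 = r)
    (h₂c : G.dist u₂ c = r) (h₂b : G.dist u₂ b = r + 1) (h₂a : G.dist u₂ a ≤ r) :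
    G.dist u₂ u₁ = 2 * r := by
  obtain ⟨n, rfl⟩ : ∃ n, r = n + 1 := ⟨_, h₁b.symm⟩
  have h₁b' : G.dist u₁ b = n := by omega
  rcases hdh.dist_eq_or_exists_closer hconn hbc.symm h₂c h₂b h₁c h₁b' with h | ⟨x, hxc, h₂x, h₁x⟩
  · omega
  exfalso
  have h₂x' : G.dist u₂ x = n := by omega
  have h₂a' := dist_le_dist_succ_of_adj hconn u₂ hac
  have h₂a_cases : G.dist u₂ a = n + 1 ∨ G.dist u₂ a = n := by omega
  rcases h₂a_cases with h₂a | h₂a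
  · have := dist_le_dist_succ_of_adj hconn u₁
      (hdh.adj_of_adj hconn hac.symm h₂c h₂a h₂x' hxc)
    omega
  · cases n with
    | zero =>
      rw [hconn.dist_eq_zero_iff] at h₁b' h₁x
      subst h₁b' h₁x
      omega
    | succ m =>
      obtain ⟨z, hzb, h₁z⟩ := exists_adj_dist_eq hconn h₁b'
      have hzx := hdh.adj_of_common_adj hconn hbc hxc.symm h₁b' h₁x h₁c h₁z hzb
      have h3 := dist_le_dist_succ_of_adj hconn u₂ hzb
      have h4 := dist_le_dist_succ_of_adj hconn u₂ hzx.symm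
      have haz := hdh.adj_of_common_adj hconn hbc.symm hzb.symm h₂c (by omega) h₂b h₂a hac
      have := dist_le_dist_succ_of_adj hconn u₁ haz.symm
      omega

theorem dist_le_ecc {V : Type*} [Fintype V] (G : SimpleGraph V) (v u : V) :
    G.dist v u ≤ ecc G v :=
  Finset.le_sup (f := fun u => G.dist v u) (Finset.mem_univ u)

theorem dist_le_diam {V : Type*} [Fintype V] (G : SimpleGraph V) (v u : V) :
    G.dist v u ≤ diam G :=
  (dist_le_ecc G v u).trans (Finset.le_sup (f := fun v => ecc G v) (Finset.mem_univ v))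

theorem exists_rad_lt_dist {V : Type*} [Fintype V] (G : SimpleGraph V) {v : V}
    (hv : v ∉ center G) : ∃ u, rad G < G.dist v u := by
  have h1 : rad G ≤ ecc G v := Nat.sInf_le ⟨v, rfl⟩
  have h2 : rad G < ecc G v := lt_of_le_of_ne h1 fun h => hv h.symm
  obtain ⟨u, -, hu⟩ := Finset.lt_sup_iff.mp h2
  exact ⟨u, hu⟩

theorem exists_mem_center {V : Type*} [Fintype V] [Nonempty V] (G : SimpleGraph V) :
    ∃ c, c ∈ center G :=
  Nat.sInf_mem (Set.range_nonempty (ecc G))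

/-- In a finite connected distance-hereditary graph, the center is a diameter
certificate: for every vertex `v` there is a central vertex `c` with
`d(v,c) + rad(G) ≤ diam(G)`. -/
theorem center_is_diameter_certificate {V : Type*} [Fintype V] (G : SimpleGraph V)
    (hconn : G.Connected) (hdh : DistHereditary G) :
    ∀ v : V, ∃ c : V, c ∈ center G ∧ G.dist v c + rad G ≤ diam G := by
  classical
  intro v
  have := hconn.nonempty
  obtain ⟨c, hc, hcmin⟩ := Set.exists_min_image (center G) (G.dist v) (Set.toFinite _)
    (exists_mem_center G)
  refine ⟨c, hc, ?_⟩
  by_contra! hlt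
  have hcr : ∀ u, G.dist u c ≤ rad G := fun u => by
    rw [SimpleGraph.dist_comm, ← show ecc G c = rad G from hc]
    exact dist_le_ecc G c u
  obtain ⟨k, hk⟩ : ∃ k, G.dist v c = k + 1 := by
    refine Nat.exists_eq_succ_of_ne_zero fun h => ?_
    have h1 : ecc G c ≤ diam G := Finset.le_sup (f := fun v => ecc G v) (Finset.mem_univ c)
    have h2 : ecc G c = rad G := hc
    omega
  -- every neighbour of `c` towards `v` is non-central
  have hfar : ∀ a, G.Adj a c → G.dist v a = k → ∃ u, G.dist u a = rad G + 1 ∧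
      G.dist u c = rad G := fun a hac hva => by
    have ha : a ∉ center G := fun h => by
      have := hcmin a h
      omega
    obtain ⟨u, hu⟩ := exists_rad_lt_dist G ha
    rw [SimpleGraph.dist_comm] at hu
    have h1 := dist_le_dist_succ_of_adj hconn u hac.symm
    have h2 := hcr u
    exact ⟨u, by omega, by omega⟩
  let near : V → Finset V := fun a => {u | G.dist u a ≤ rad G}
  obtain ⟨a, ⟨hac, hva⟩, hamax⟩ := Set.exists_max_image {a | G.Adj a c ∧ G.dist v a = k}
    (fun a => (near a).card) (Set.toFinite _) (exists_adj_dist_eq hconn hk)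
  obtain ⟨u₁, h₁a, h₁c⟩ := hfar a hac hva
  rcases hdh.dist_eq_or_exists_closer hconn hac.symm h₁c h₁a hk hva with h | ⟨b, hbc, h₁b, hvb⟩
  · have := dist_le_diam G u₁ v
    omega
  obtain ⟨u₂, h₂a, h₂b⟩ : ∃ u₂, G.dist u₂ a ≤ rad G ∧ rad G < G.dist u₂ b := by
    by_contra! hsub
    have hss : near a ⊂ near b := by
      refine Finset.ssubset_iff_of_subset (fun u hu => ?_) |>.mpr ⟨u₁, ?_, ?_⟩
      · simp only [near, Finset.mem_filter_univ] at hu ⊢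
        exact hsub u hu
      · simp only [near, Finset.mem_filter_univ]
        omega
      · simp only [near, Finset.mem_filter_univ]
        omega
    exact absurd (hamax b ⟨hbc, hvb⟩) (Finset.card_lt_card hss).not_ge
  have h1 := dist_le_dist_succ_of_adj hconn u₂ hbc.symm
  have h2 := hcr u₂
  have h3 := hdh.dist_eq_two_mul hconn hac hbc h₁c h₁a h₁b (by omega) (by omega) h₂a
  have h4 := dist_le_diam G u₂ u₁
  have h5 := hcr v
  omega
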